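/- Mandal–Raja Sridharan theorem: Let A be a commutative Noetherian ring, R = A[T], and let I₁, I₂ be comaximal ideals of R such that I₁ contains a monic polynomial and I₂ is extended from A, i.e. I₂ = I₂(0)R where I₂(0) is the image of I₂ under evaluation T ↦ 0. Let P be a finitely generated projective A-module of constant rank r ≥ dim(R/I₁) + 2 and let I = I₁ ∩ I₂. Let ρ : P → A be an A-linear map with ρ(P) = I(0), and let δ : P[T] → R be an R-linear map with δ(P[T]) ⊆ I₁, δ(P[T]) + I₁² = I₁ (so δ induces a surjection P[T]/I₁P[T] ↠ I₁/I₁²), and δ(p)(0) − ρ(p) ∈ I₁(0)² for all p ∈ P. Then there exists an R-linear map η : P[T] → R with η(P[T]) = I and η(p)(0) = ρ(p) for all p ∈ P. -/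

import Mathlib

open Polynomial

namespace MRS

section LinAlg

variable {κ V : Type*} [Field κ] [AddCommGroup V] [Module κ V]

lemma exists_linInd_of_le_finrank {α : Type*} [Finite α] (v : α → V) (k : ℕ)
    (h : k ≤ Module.finrank κ (Submodule.span κ (Set.range v))) :
    ∃ f : Fin k → α, LinearIndependent κ (fun i => v (f i)) := by
  have : Module.Finite κ (Submodule.span κ (Set.range v)) :=
    Module.Finite.span_of_finite κ (Set.finite_range v)
  obtain ⟨g, hg, -, hli⟩ := Submodule.exists_fun_fin_finrank_span_eq κ (Set.range v)
  choose f hf using hg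
  refine ⟨fun i => f (Fin.castLE h i), ?_⟩
  have : (fun i => v (f (Fin.castLE h i))) = g ∘ Fin.castLE h := by
    ext i; simp [hf]
  rw [this]
  exact hli.comp _ (Fin.castLE_injective h)

/-- rank at least `k` iff some `k × k` minor is nonzero. -/
lemma le_finrank_iff_minor {α ι : Type*} [Finite α] [Finite ι] (v : α → ι → κ) (k : ℕ) :
    k ≤ Module.finrank κ (Submodule.span κ (Set.range v)) ↔
      ∃ (f : Fin k → α) (g : Fin k → ι), ((Matrix.of v).submatrix f g).det ≠ 0 := by
  constructor
  · intro h
    obtain ⟨f, hf⟩ := exists_linInd_of_le_finrank v k h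
    have := Fintype.ofFinite ι
    let N : Matrix (Fin k) ι κ := Matrix.of fun i j => v (f i) j
    have hN : N.rank = k := by
      have : LinearIndependent κ N.row := hf
      simpa using this.rank_matrix
    rw [← Matrix.rank_transpose, Matrix.rank_eq_finrank_span_row] at hN
    obtain ⟨g, hg⟩ := exists_linInd_of_le_finrank (κ := κ) (Matrix.row (Matrix.transpose N)) k hN.ge
    refine ⟨f, g, ?_⟩
    have h2 : LinearIndependent κ (Matrix.transpose ((Matrix.of v).submatrix f g)).row := hg
    rw [Matrix.linearIndependent_rows_iff_isUnit, Matrix.isUnit_transpose,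
      Matrix.isUnit_iff_isUnit_det] at h2
    exact h2.ne_zero
  · rintro ⟨f, g, h⟩
    have h2 : LinearIndependent κ (((Matrix.of v).submatrix f g)).row := by
      rw [Matrix.linearIndependent_rows_iff_isUnit, Matrix.isUnit_iff_isUnit_det]
      exact isUnit_iff_ne_zero.mpr h
    have h3 : LinearIndependent κ (fun i => v (f i)) := by
      refine LinearIndependent.of_comp (LinearMap.funLeft κ κ g) ?_
      exact h2
    have := finrank_span_eq_card h3
    rw [Fintype.card_fin] at this
    rw [← this]
    have : Module.Finite κ (Submodule.span κ (Set.range v)) :=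
      Module.Finite.span_of_finite κ (Set.finite_range v)
    refine Submodule.finrank_mono (Submodule.span_mono ?_)
    rintro _ ⟨i, rfl⟩
    exact ⟨f i, rfl⟩

/-- elimination of one vector from a dependent family -/
lemma exists_elim {n : ℕ} (w : Fin n → V) (z : V) (β : κ) (hβ : β ≠ 0)
    (h : Module.finrank κ (Submodule.span κ (Set.range w ∪ {z})) ≤ n) :
    ∃ c : Fin n → ℕ, z ∈ Submodule.span κ (Set.range fun i => w i + (β * (c i : κ)) • z) := by
  by_cases hz : z ∈ Submodule.span κ (Set.range w)
  · exact ⟨0, by simpa using hz⟩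
  have hdep : ¬ LinearIndependent κ w := by
    intro hli
    have h1 : LinearIndependent κ (Fin.snoc w z : Fin (n+1) → V) :=
      hli.finSnoc hz
    have h2 := finrank_span_eq_card h1
    rw [Fintype.card_fin] at h2
    have h3 : Set.range (Fin.snoc w z : Fin (n+1) → V) = Set.range w ∪ {z} := by
      rw [Fin.range_snoc]; ext; simp
    rw [h3] at h2
    omega
  rw [Fintype.not_linearIndependent_iff] at hdep
  obtain ⟨g, hg, i, hi⟩ := hdep
  refine ⟨Pi.single i 1, ?_⟩
  set S := Submodule.span κ (Set.range fun k => w k + (β * ((Pi.single i 1 : Fin n → ℕ) k : κ)) • z)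
  have h1 : ∑ k, g k • (w k + (β * ((Pi.single i 1 : Fin n → ℕ) k : κ)) • z) ∈ S :=
    Submodule.sum_mem _ fun k _ => Submodule.smul_mem _ _ (Submodule.subset_span ⟨k, rfl⟩)
  have h2 : ∑ k, g k • (w k + (β * ((Pi.single i 1 : Fin n → ℕ) k : κ)) • z) = (g i * β) • z := by
    simp_rw [smul_add, Finset.sum_add_distrib, hg, zero_add]
    rw [Finset.sum_eq_single i]
    · simp [smul_smul]
    · intro b _ hb; simp [hb]
    · simp
  rw [h2] at h1
  exact (Submodule.smul_mem_iff _ (mul_ne_zero hi hβ)).mp h1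

end LinAlg

section EE

variable {R : Type*} [CommRing R] {ι : Type*}

/-- reduction of a vector modulo a prime -/
noncomputable def red (p : PrimeSpectrum R) (v : ι → R) : ι → p.asIdeal.ResidueField :=
  fun j => algebraMap R p.asIdeal.ResidueField (v j)

lemma red_add (p : PrimeSpectrum R) (v w : ι → R) : red p (v + w) = red p v + red p w := by
  ext; simp [red]

lemma red_smul (p : PrimeSpectrum R) (a : R) (v : ι → R) :
    red p (a • v) = algebraMap R p.asIdeal.ResidueField a • red p v := by
  ext; simp [red]

noncomputable def spn {α : Type*} (p : PrimeSpectrum R) (w : α → ι → R) :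
    Submodule p.asIdeal.ResidueField (ι → p.asIdeal.ResidueField) :=
  Submodule.span _ (Set.range fun a => red p (w a))

noncomputable def rk {α : Type*} (p : PrimeSpectrum R) (w : α → ι → R) : ℕ :=
  Module.finrank p.asIdeal.ResidueField (spn p w)

lemma exists_rank_ideal {α : Type*} [Finite α] [Finite ι] (w : α → ι → R) (t : ℕ) :
    ∃ 𝔞 : Ideal R, ∀ p : PrimeSpectrum R, rk p w ≤ t ↔ 𝔞 ≤ p.asIdeal := by
  refine ⟨Ideal.span {x | ∃ (f : Fin (t+1) → α) (g : Fin (t+1) → ι),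
    x = ((Matrix.of w).submatrix f g).det}, fun p => ?_⟩
  rw [← not_iff_not, not_le, Nat.lt_iff_add_one_le, rk, spn, le_finrank_iff_minor, Ideal.span_le,
    Set.not_subset]
  have key : ∀ (f : Fin (t+1) → α) (g : Fin (t+1) → ι),
      ((Matrix.of fun a => red p (w a)).submatrix f g).det =
        algebraMap R p.asIdeal.ResidueField ((Matrix.of w).submatrix f g).det := by
    intro f g
    rw [RingHom.map_det]
    rfl
  constructor
  · rintro ⟨f, g, h⟩
    refine ⟨_, ⟨f, g, rfl⟩, ?_⟩
    rw [key] at h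
    simpa using h
  · rintro ⟨_, ⟨f, g, rfl⟩, h⟩
    refine ⟨f, g, ?_⟩
    rw [key]
    simpa using h

/-- simultaneous elimination at finitely many primes -/
lemma exists_finite_elim (e : R) {n : ℕ} (w : Fin n → ι → R) (z : ι → R)
    (E : Finset (PrimeSpectrum R)) (hE : ∀ p ∈ E, e ∉ p.asIdeal)
    (hrk : ∀ p ∈ E, Module.finrank p.asIdeal.ResidueField (Submodule.span p.asIdeal.ResidueField
      ((Set.range fun i => red p (w i)) ∪ {red p z})) ≤ n) :
    ∃ a : Fin n → R, ∀ p ∈ E, red p z ∈ spn p (fun i => w i + (e * a i) • z) := by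
  classical
  induction hn : E.card generalizing E with
  | zero => exact ⟨0, by simp [Finset.card_eq_zero.mp hn]⟩
  | succ m ih =>
    obtain ⟨p, hp⟩ := E.exists_minimal (Finset.card_pos.mp (by omega))
    obtain ⟨a, ha⟩ := ih (E.erase p) (fun q hq => hE q (Finset.mem_of_mem_erase hq))
      (fun q hq => hrk q (Finset.mem_of_mem_erase hq))
      (by rw [Finset.card_erase_of_mem hp.1]; omega)
    have hb : ¬ ((E.erase p).inf fun q => q.asIdeal) ≤ p.asIdeal := by
      rw [Ideal.IsPrime.inf_le' p.isPrime]
      rintro ⟨q, hq, hqp⟩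
      have hq1 := Finset.mem_of_mem_erase hq
      have : p ≤ q := hp.2 hq1 hqp
      exact Finset.ne_of_mem_erase hq (le_antisymm hqp this)
    obtain ⟨b, hbE, hbp⟩ := SetLike.not_le_iff_exists.mp hb
    let κ := p.asIdeal.ResidueField
    have hβ : algebraMap R κ (e * b) ≠ 0 := by
      rw [ne_eq, Ideal.algebraMap_residueField_eq_zero]
      intro h
      rcases p.isPrime.mem_or_mem h with h | h
      · exact hE p hp.1 h
      · exact hbp h
    obtain ⟨c, hc⟩ := exists_elim (fun i => red p (w i + (e * a i) • z)) (red p z) _ hβ (by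
      refine le_trans ?_ (hrk p hp.1)
      have : Module.Finite κ (Submodule.span κ ((Set.range fun i => red p (w i)) ∪ {red p z})) :=
        Module.Finite.span_of_finite κ ((Set.finite_range _).union (Set.finite_singleton _))
      refine Submodule.finrank_mono (Submodule.span_le.mpr ?_)
      rintro x (⟨i, rfl⟩ | rfl)
      · simp only [red_add, red_smul]
        exact Submodule.add_mem _ (Submodule.subset_span (Or.inl ⟨i, rfl⟩))
          (Submodule.smul_mem _ _ (Submodule.subset_span (Or.inr rfl)))
      · exact Submodule.subset_span (Or.inr rfl))
    refine ⟨fun i => a i + b * c i, fun q hq => ?_⟩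
    by_cases hqp : q = p
    · subst hqp
      unfold spn
      have hfe : (fun i => red q (w i + (e * (a i + b * c i)) • z)) =
          fun i => red q (w i + (e * a i) • z) + (algebraMap R κ (e * b) * (c i : κ)) • red q z := by
        funext i
        simp only [red_add, red_smul, map_mul, map_add, map_natCast, add_smul, mul_add, add_assoc,
          mul_assoc, κ]
      rw [hfe]
      exact hc
    · have hq' : q ∈ E.erase p := Finset.mem_erase.mpr ⟨hqp, hq⟩
      have hbq : b ∈ q.asIdeal := by
        have := (Submodule.mem_finsetInf (s := E.erase p) (p := fun q => q.asIdeal)).mp hbE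
        exact this q hq'
      have hb0 : algebraMap R q.asIdeal.ResidueField b = 0 := by
        rwa [Ideal.algebraMap_residueField_eq_zero]
      have := ha q hq'
      unfold spn at this ⊢
      have hfe : (fun i => red q (w i + (e * (a i + b * c i)) • z)) =
          fun i => red q (w i + (e * a i) • z) := by
        funext i
        simp only [red_add, red_smul, map_mul, map_add, hb0, zero_mul, add_zero]
      rw [hfe]
      exact this

/-- **Eisenbud–Evans / Serre** general position lemma, vector form. -/
theorem eisenbud_evans [Finite ι] [IsNoetherianRing R] (K : Ideal R) (e : R) (d : PrimeSpectrum R → ℕ)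
    (hd : ∀ p q : PrimeSpectrum R, K ≤ p.asIdeal → K ≤ q.asIdeal → q < p → d p + 1 ≤ d q) (n : ℕ) :
    ∀ w : Fin (n + 1) → ι → R,
    (∀ p : PrimeSpectrum R, K ≤ p.asIdeal → e ∉ p.asIdeal → min (n + 1) (d p + 1) ≤ rk p w) →
    ∃ y ∈ Submodule.span R (Set.range fun i : Fin n => w i.succ),
      ∀ p : PrimeSpectrum R, K ≤ p.asIdeal → e ∉ p.asIdeal → ∃ j, (w 0 + e • y) j ∉ p.asIdeal := by
  classical
  induction n with
  | zero =>
    intro w hw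
    refine ⟨0, Submodule.zero_mem _, fun p hK he => ?_⟩
    have h := hw p hK he
    by_contra! hcon
    have h0 : red p (w 0) = 0 := by
      ext j
      have := hcon j
      simpa [red] using this
    have : spn p w = ⊥ := by
      rw [spn, Submodule.span_eq_bot]
      rintro _ ⟨i, rfl⟩
      have : i = 0 := Fin.fin_one_eq_zero i
      subst this
      exact h0
    rw [rk, this] at h
    simp at h
  | succ n ih =>
    intro w hw
    choose 𝔞 h𝔞 using fun t : ℕ => exists_rank_ideal w t
    let w₁ : Fin (n+1) → ι → R := fun i => w i.castSucc
    let z := w (Fin.last (n+1))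
    have hspn : ∀ p : PrimeSpectrum R, spn p w = Submodule.span p.asIdeal.ResidueField
      ((Set.range fun i => red p (w₁ i)) ∪ {red p z}) := by
      intro p
      rw [spn]
      congr 1
      ext x
      constructor
      · rintro ⟨i, rfl⟩
        refine Fin.lastCases (Or.inr rfl) (fun j => Or.inl ⟨j, rfl⟩) i
      · rintro (⟨j, rfl⟩ | rfl)
        · exact ⟨j.castSucc, rfl⟩
        · exact ⟨Fin.last _, rfl⟩
    let E₀ : Set (PrimeSpectrum R) := {p | e ∉ p.asIdeal ∧ ∃ t ∈ Finset.range (n+2),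
      p.asIdeal ∈ (K ⊔ 𝔞 t).minimalPrimes}
    have hfin : E₀.Finite := by
      have h1 : (⋃ t ∈ Finset.range (n+2), (K ⊔ 𝔞 t).minimalPrimes).Finite :=
        (Finset.range (n+2)).finite_toSet.biUnion
          fun t _ => Ideal.finite_minimalPrimes_of_isNoetherianRing R _
      refine (h1.preimage (f := PrimeSpectrum.asIdeal)
        (fun p _ q _ h => PrimeSpectrum.ext h)).subset ?_
      rintro p ⟨-, t, ht, hp⟩
      simp only [Set.mem_preimage, Set.mem_iUnion]
      exact ⟨t, ht, hp⟩
    obtain ⟨a, ha⟩ := exists_finite_elim e w₁ z hfin.toFinset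
      (fun p hp => ((Set.Finite.mem_toFinset _).mp hp).1) (by
        intro p hp
        obtain ⟨-, t, ht, hp⟩ := (Set.Finite.mem_toFinset _).mp hp
        have h1 : rk p w ≤ t := (h𝔞 t p).mpr (le_sup_right.trans hp.1.2)
        rw [rk, hspn] at h1
        have := Finset.mem_range.mp ht
        omega)
    let w' : Fin (n+1) → ι → R := fun i => w₁ i + (e * a i) • z
    have hfinK : ∀ (p : PrimeSpectrum R), Module.Finite p.asIdeal.ResidueField (spn p w') :=
      fun p => Module.Finite.span_of_finite _ (Set.finite_range _)
    have key0 : ∀ p : PrimeSpectrum R, spn p w ≤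
        spn p w' ⊔ Submodule.span p.asIdeal.ResidueField {red p z} := by
      intro p
      rw [hspn, Submodule.span_le]
      have hz : red p z ∈ spn p w' ⊔ Submodule.span p.asIdeal.ResidueField {red p z} :=
        Submodule.mem_sup_right (Submodule.mem_span_singleton_self _)
      rintro x (⟨i, rfl⟩ | rfl)
      · have h1 : red p (w' i) ∈ spn p w' ⊔ Submodule.span p.asIdeal.ResidueField {red p z} :=
          Submodule.mem_sup_left (Submodule.subset_span ⟨i, rfl⟩)
        have h2 : red p (w₁ i) = red p (w' i)
            - algebraMap R p.asIdeal.ResidueField (e * a i) • red p z := by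
          simp only [w', red_add, red_smul, add_sub_cancel_right]
        simp only [SetLike.mem_coe]
        rw [h2]
        exact Submodule.sub_mem _ h1 (Submodule.smul_mem _ _ hz)
      · exact hz
    have key1 : ∀ p : PrimeSpectrum R, rk p w ≤ rk p w' + 1 := by
      intro p
      have := hfinK p
      refine (Submodule.finrank_mono (key0 p)).trans ?_
      refine (Submodule.finrank_add_le_finrank_add_finrank _ _).trans ?_
      have := finrank_span_le_card (R := p.asIdeal.ResidueField) ({red p z} : Set (ι → p.asIdeal.ResidueField))
      simp only [Set.toFinset_singleton, Finset.card_singleton] at this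
      unfold rk
      omega
    have key2 : ∀ p : PrimeSpectrum R, red p z ∈ spn p w' → rk p w ≤ rk p w' := by
      intro p hz
      have := hfinK p
      refine Submodule.finrank_mono ((key0 p).trans ?_)
      rw [sup_le_iff]
      exact ⟨le_rfl, by simpa using hz⟩
    obtain ⟨y', hy', hy⟩ := ih w' (by
      intro p hK he
      have h1 := hw p hK he
      have h2 := key1 p
      by_cases ht : n + 2 ≤ rk p w
      · omega
      obtain ⟨q, hq, hqp⟩ := Ideal.exists_minimalPrimes_le (I := K ⊔ 𝔞 (rk p w)) (J := p.asIdeal)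
        (sup_le hK ((h𝔞 _ p).mp le_rfl))
      let q' : PrimeSpectrum R := ⟨q, hq.1.1⟩
      have heq : e ∉ q'.asIdeal := fun h => he (hqp h)
      have hKq : K ≤ q'.asIdeal := le_sup_left.trans hq.1.2
      have hqE : q' ∈ E₀ := ⟨heq, rk p w, Finset.mem_range.mpr (by omega), hq⟩
      by_cases hpq : q' = p
      · have := key2 q' (ha q' ((Set.Finite.mem_toFinset _).mpr hqE))
        rw [hpq] at this
        omega
      · have hlt : q' < p := lt_of_le_of_ne hqp hpq
        have h3 := hd p q' hK hKq hlt
        have h4 := hw q' hKq heq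
        have h5 : rk q' w ≤ rk p w := (h𝔞 _ q').mpr (le_sup_right.trans hq.1.2)
        omega)
    refine ⟨a 0 • z + y', ?_, ?_⟩
    · refine Submodule.add_mem _ (Submodule.smul_mem _ _ (Submodule.subset_span
        ⟨Fin.last n, rfl⟩)) ?_
      refine (Submodule.span_le.mpr ?_) hy'
      rintro _ ⟨i, rfl⟩
      refine Submodule.add_mem _ (Submodule.subset_span ⟨i.castSucc, rfl⟩)
        (Submodule.smul_mem _ _ (Submodule.subset_span ⟨Fin.last n, rfl⟩))
    · intro p hK he
      have := hy p hK he
      have h0 : w 0 + e • (a 0 • z + y') = w' 0 + e • y' := by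
        simp only [w', w₁, smul_add, smul_smul, Fin.castSucc_zero, add_assoc]
      rwa [h0]

end EE
end MRS

namespace MRS

section Res
variable {A : Type*} [CommRing A]

lemma exists_C_mem_of_comax (c : Ideal A[X]) (J : Ideal A) (f : A[X]) (hf : f ∈ c) (n : ℕ)
    (hn : f.natDegree ≤ n) (hu : f.coeff n - 1 ∈ J) (hc : c ⊔ J.map (C : A →+* A[X]) = ⊤) :
    ∃ s : A, s - 1 ∈ J ∧ C s ∈ c := by
  have h1 : (1 : A[X]) ∈ c ⊔ J.map (C : A →+* A[X]) := by rw [hc]; trivial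
  obtain ⟨h, hh, k, hk, hhk⟩ := Submodule.mem_sup.mp h1
  obtain ⟨p, q, -, -, e⟩ := exists_mul_add_mul_eq_C_resultant (m := n) (n := h.natDegree + 1)
    f h hn (by omega) (by omega)
  refine ⟨_, ?_, e ▸ c.add_mem (c.mul_mem_right _ hf) (c.mul_mem_right _ hh)⟩
  rw [← Ideal.Quotient.eq_zero_iff_mem] at hu ⊢
  have hk0 : k.map (Ideal.Quotient.mk J) = 0 := by
    rw [Ideal.mem_map_C_iff] at hk
    ext i
    simpa [Ideal.Quotient.eq_zero_iff_mem] using hk i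
  have hh1 : h.map (Ideal.Quotient.mk J) = 1 := by
    have := congrArg (Polynomial.map (Ideal.Quotient.mk J)) hhk
    simpa [hk0] using this
  rw [map_sub, map_one, sub_eq_zero] at hu ⊢
  rw [← resultant_map_map, hh1, resultant_one_right, coeff_map, hu, one_pow]

lemma isIntegral_quot (I : Ideal A[X]) (f : A[X]) (hf : f ∈ I) (hm : f.Monic) :
    Algebra.IsIntegral A (A[X] ⧸ I) := by
  have hX : IsIntegral A (Ideal.Quotient.mk I X) := by
    refine ⟨f, hm, ?_⟩
    have : eval₂ (algebraMap A (A[X] ⧸ I)) (Ideal.Quotient.mk I X) f = Ideal.Quotient.mk I f := by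
      conv_rhs => rw [← eval₂_C_X (p := f)]
      rw [hom_eval₂]
      rfl
    rw [this, Ideal.Quotient.eq_zero_iff_mem]
    exact hf
  refine ⟨fun x => ?_⟩
  obtain ⟨p, rfl⟩ := Ideal.Quotient.mk_surjective x
  induction p using Polynomial.induction_on with
  | C a => exact isIntegral_algebraMap (R := A) (A := A[X] ⧸ I) (x := a)
  | add p q hp hq => rw [map_add]; exact hp.add hq
  | monomial n a _ =>
    rw [map_mul, map_pow]
    exact (isIntegral_algebraMap (R := A) (A := A[X] ⧸ I) (x := a)).mul (hX.pow _)

lemma comap_C_lt (p q : PrimeSpectrum A[X]) (f : A[X]) (hf : f ∈ p.asIdeal) (hm : f.Monic)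
    (h : p < q) : PrimeSpectrum.comap C p < PrimeSpectrum.comap C q := by
  have := isIntegral_quot p.asIdeal f hf hm
  have hpq : p.asIdeal < q.asIdeal := h
  have hlt : (⊥ : Ideal (A[X] ⧸ p.asIdeal)) < q.asIdeal.map (Ideal.Quotient.mk p.asIdeal) := by
    rw [bot_lt_iff_ne_bot, ne_eq, Ideal.map_eq_bot_iff_le_ker, Ideal.mk_ker]
    exact not_le_of_gt hpq
  have h2 := Ideal.IsIntegral.comap_lt_comap (R := A) hlt
  have h3 : algebraMap A (A[X] ⧸ p.asIdeal) = (Ideal.Quotient.mk p.asIdeal).comp C := rfl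
  rw [h3, ← Ideal.comap_comap, ← Ideal.comap_comap,
    Ideal.comap_map_of_surjective _ Ideal.Quotient.mk_surjective,
    ← RingHom.ker_eq_comap_bot, Ideal.mk_ker, sup_eq_left.mpr hpq.le] at h2
  exact h2

lemma coheight_bound (I : Ideal A[X]) (f : A[X]) (hf : f ∈ I) (hm : f.Monic) (r : ℕ)
    (hdim : ringKrullDim (A[X] ⧸ I) + 2 ≤ (r : WithBot ℕ∞))
    (p : PrimeSpectrum A) (hp : I.comap C ≤ p.asIdeal) : Order.coheight p + 2 ≤ (r : ℕ∞) := by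
  have := isIntegral_quot I f hf hm
  obtain ⟨Q, -, hQ, hQp⟩ := Ideal.exists_ideal_over_prime_of_isIntegral (S := A[X] ⧸ I)
    p.asIdeal ⊥ (by
      have h3 : algebraMap A (A[X] ⧸ I) = (Ideal.Quotient.mk I).comp C := rfl
      rw [h3, ← Ideal.comap_comap, ← RingHom.ker_eq_comap_bot, Ideal.mk_ker]
      exact hp)
  have h1 : Order.coheight p ≤ Order.coheight (⟨Q, hQ⟩ : PrimeSpectrum (A[X] ⧸ I)) := by
    refine Order.coheight_le fun l hl => ?_
    have : Q.LiesOver (RelSeries.head l).asIdeal := ⟨by rw [hl]; exact hQp.symm⟩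
    obtain ⟨L, hL, hL2, -⟩ := Ideal.exists_ltSeries_of_hasGoingUp (S := A[X] ⧸ I) l Q
    rw [← hL]
    exact Order.length_le_coheight (by rw [hL2])
  have h2 := Order.coheight_le_krullDim (⟨Q, hQ⟩ : PrimeSpectrum (A[X] ⧸ I))
  have h3 : ((Order.coheight p : ℕ∞) : WithBot ℕ∞) ≤ ringKrullDim (A[X] ⧸ I) :=
    (WithBot.coe_le_coe.mpr h1).trans h2
  have h4 : ((Order.coheight p : ℕ∞) : WithBot ℕ∞) + 2 ≤ (r : WithBot ℕ∞) :=
    (add_le_add_left h3 2).trans hdim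
  have h5 : ((Order.coheight p + 2 : ℕ∞) : WithBot ℕ∞) ≤ ((r : ℕ∞) : WithBot ℕ∞) := h4
  exact WithBot.coe_le_coe.mp h5

end Res
end MRS

namespace MRS

section Final
variable {A : Type*} [CommRing A] {P : Type*} [AddCommGroup P] [Module A P]

lemma exists_final (I₁ : Ideal A[X]) (𝔟 : Ideal A) (ρ : P →ₗ[A] A) (φ : P →ₗ[A] A[X]) (t : A)
    (ht1 : C (t - 1) ∈ I₁) (htb : t ∈ 𝔟) (hφ0 : ∀ p, eval 0 (φ p) = ρ p)
    (hρ : LinearMap.range ρ = (I₁ ⊓ 𝔟.map C).map (evalRingHom (0 : A)))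
    (hφI : ∀ p, φ p ∈ I₁) (hN : ∀ h ∈ I₁, C t * h ∈ Ideal.span (Set.range φ)) :
    ∃ w : P →ₗ[A] A[X], Ideal.span (Set.range w) = I₁ ⊓ 𝔟.map C ∧
      ∀ p, eval 0 (w p) = ρ p := by
  let θ : A[X] →ₐ[A] A[X] := aeval (C (t ^ 3) * X)
  let w : P →ₗ[A] A[X] := θ.toLinearMap ∘ₗ φ
  have F1 : ∀ g, ∃ k, θ g = g + C (t ^ 3 - 1) * k := by
    intro g
    obtain ⟨k, hk⟩ := sub_dvd_eval_sub (C (t ^ 3) * X) X (g.map (C : A →+* A[X]))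
    refine ⟨X * k, ?_⟩
    rw [eval_map, eval_map, eval₂_C_X] at hk
    have h1 : θ g = eval₂ C (C (t ^ 3) * X) g := by simp only [θ, aeval_def]; rfl
    rw [h1, ← sub_eq_iff_eq_add', hk, map_sub, map_one]
    ring
  have F2 : ∀ g, ∃ k, θ g = C (eval 0 g) + C (t ^ 3) * k := by
    intro g
    obtain ⟨k, hk⟩ := sub_dvd_eval_sub (C (t ^ 3) * X) (C 0) (g.map (C : A →+* A[X]))
    refine ⟨X * k, ?_⟩
    rw [eval_map, eval_map, eval₂_at_apply] at hk
    have h1 : θ g = eval₂ C (C (t ^ 3) * X) g := by simp only [θ, aeval_def]; rfl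
    rw [h1, ← sub_eq_iff_eq_add', hk, map_zero]
    ring
  set N := Ideal.span (Set.range φ) with hNdef
  set W := Ideal.span (Set.range w) with hWdef
  have hNW : ∀ g ∈ N, θ g ∈ W := by
    intro g hg
    have : W = N.map θ := by
      rw [hNdef, Ideal.map_span, hWdef, ← Set.range_comp]
      rfl
    rw [this]
    exact Ideal.mem_map_of_mem θ hg
  have hθC : ∀ a : A, θ (C a) = C a := fun a => θ.commutes a
  have hj3 : C (t ^ 3 - 1) ∈ I₁ := by
    have : (C (t ^ 3 - 1) : A[X]) = C (t ^ 2 + t + 1) * C (t - 1) := by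
      rw [← C_mul]; congr 1; ring
    rw [this]
    exact I₁.mul_mem_left _ ht1
  have htj : C t * C (t ^ 3 - 1) ∈ W := by
    have := hNW _ (hN _ hj3)
    rwa [map_mul, hθC, hθC] at this
  have htI : ∀ h ∈ I₁, C t * h ∈ W := by
    intro h hh
    have h1 := hNW _ (hN _ hh)
    obtain ⟨k, hk⟩ := F1 h
    rw [map_mul, hθC, hk, mul_add] at h1
    refine (Submodule.add_mem_iff_left _ ?_).mp h1
    rw [← mul_assoc]
    exact W.mul_mem_right _ htj
  have hρb : ∀ p, ρ p ∈ 𝔟 := by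
    intro p
    have h1 : ρ p ∈ LinearMap.range ρ := ⟨p, rfl⟩
    rw [hρ] at h1
    have h2 := Ideal.map_mono (f := evalRingHom (0 : A)) (inf_le_right : I₁ ⊓ 𝔟.map C ≤ 𝔟.map C) h1
    rw [Ideal.map_map] at h2
    have h3 : (evalRingHom (0 : A)).comp C = RingHom.id A := by ext; simp
    rwa [h3, Ideal.map_id] at h2
  refine ⟨w, le_antisymm ?_ ?_, ?_⟩
  · rw [Ideal.span_le]
    rintro _ ⟨p, rfl⟩
    refine ⟨?_, ?_⟩
    · obtain ⟨k, hk⟩ := F1 (φ p)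
      change θ (φ p) ∈ I₁
      rw [hk]
      exact I₁.add_mem (hφI p) (I₁.mul_mem_right _ hj3)
    · obtain ⟨k, hk⟩ := F2 (φ p)
      change θ (φ p) ∈ 𝔟.map C
      rw [hk, hφ0]
      refine Ideal.add_mem _ (Ideal.mem_map_of_mem _ (hρb p)) (Ideal.mul_mem_right _ _
        (Ideal.mem_map_of_mem _ ?_))
      exact Ideal.pow_mem_of_mem _ htb 3 (by norm_num)
  · rintro h ⟨h1, h2⟩
    have key : ∀ g ∈ 𝔟.map (C : A →+* A[X]), C (t - 1) * g ∈ W ⊔ Ideal.span {C t} := by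
      intro g hg
      refine Submodule.span_induction (p := fun g _ => C (t - 1) * g ∈ W ⊔ Ideal.span {C t})
        ?_ ?_ ?_ ?_ hg
      · rintro _ ⟨b, hb, rfl⟩
        have h3 : (t - 1) * b ∈ LinearMap.range ρ := by
          rw [hρ]
          have : (t - 1) * b = evalRingHom 0 (C (t - 1) * C b) := by simp
          rw [this]
          exact Ideal.mem_map_of_mem _ ⟨I₁.mul_mem_right _ ht1,
            Ideal.mul_mem_left _ _ (Ideal.mem_map_of_mem _ hb)⟩
        obtain ⟨p, hp⟩ := h3
        obtain ⟨k, hk⟩ := F2 (φ p)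
        have h4 : C (t - 1) * C b = w p + C t * (- (C t ^ 2 * k)) := by
          change _ = θ (φ p) + _
          rw [hk, hφ0, hp, C_mul, C_pow]
          ring
        rw [h4]
        exact Submodule.add_mem_sup (Ideal.subset_span ⟨p, rfl⟩)
          (Ideal.mul_mem_right _ _ (Ideal.mem_span_singleton_self _))
      · simp
      · intro x y _ _ hx hy
        rw [mul_add]
        exact Ideal.add_mem _ hx hy
      · intro a x _ hx
        rw [smul_eq_mul, mul_left_comm]
        exact Ideal.mul_mem_left _ _ hx
    obtain ⟨x, hx, y, hy, hxy⟩ := Submodule.mem_sup.mp (key h h2)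
    obtain ⟨k, rfl⟩ := Ideal.mem_span_singleton'.mp hy
    have h5 : h = C t * ((1 - C (t - 1)) * h) + (C (t - 1) * x + k * (C t * C (t - 1))) := by
      have : C (t - 1) * x + k * (C t * C (t - 1)) = C (t - 1) * (x + k * C t) := by ring
      rw [this, hxy, C_sub, C_1]
      ring
    rw [h5]
    exact W.add_mem (htI _ (I₁.mul_mem_left _ h1)) (W.add_mem (W.mul_mem_left _ hx)
      (W.mul_mem_left _ (htI _ ht1)))
  · intro p
    obtain ⟨k, hk⟩ := F1 (φ p)
    change eval 0 (θ (φ p)) = _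
    rw [← hφ0]
    simp only [θ, aeval_def, ← eval_map]
    rw [eval_map, ← coe_evalRingHom, hom_eval₂]
    have h3 : (evalRingHom (0 : A)).comp (algebraMap A A[X]) = RingHom.id A := by ext; simp
    rw [h3]
    simp [coeff_zero_eq_eval_zero]

end Final
end MRS

namespace MRS

section DualBasis
open TensorProduct
variable {A : Type*} [CommRing A] {P : Type*} [AddCommGroup P] [Module A P]

lemma exists_dual_basis [Module.Finite A P] [Module.Projective A P] :
    ∃ (N : ℕ) (b : Fin N → P) (μ : Fin N → P →ₗ[A] A), ∀ x, ∑ i, μ i x • b i = x := by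
  obtain ⟨N, f, g, -, -, hfg⟩ := Module.Finite.exists_comp_eq_id_of_projective A P
  refine ⟨N, fun i => f (Pi.single i 1), fun i => LinearMap.proj i ∘ₗ g, fun x => ?_⟩
  have := LinearMap.congr_fun hfg x
  simp only [LinearMap.comp_apply, LinearMap.id_apply] at this
  conv_rhs => rw [← this]
  conv_rhs => rw [LinearMap.pi_apply_eq_sum_univ f]
  refine Finset.sum_congr rfl fun i _ => ?_
  simp only [LinearMap.comp_apply, LinearMap.proj_apply]
  congr 2
  ext j
  simp [Pi.single_apply, eq_comm]

lemma rank_dual {N : ℕ} (b : Fin N → P) (μ : Fin N → P →ₗ[A] A) (h : ∀ x, ∑ i, μ i x • b i = x)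
    (κ : Type*) [Field κ] [Algebra A κ] :
    Module.finrank κ (κ ⊗[A] P) = Module.finrank κ (Submodule.span κ (Set.range
      fun i => fun j => algebraMap A κ (μ i (b j)))) := by
  let M : Fin N → Module.Dual κ (κ ⊗[A] P) :=
    fun i => LinearMap.liftBaseChange κ ((Algebra.linearMap A κ) ∘ₗ μ i)
  let E : Module.Dual κ (κ ⊗[A] P) →ₗ[κ] (Fin N → κ) :=
    LinearMap.pi fun j => LinearMap.applyₗ ((1 : κ) ⊗ₜ[A] b j)
  have hE : ∀ ψ j, E ψ j = ψ ((1 : κ) ⊗ₜ[A] b j) := fun ψ j => rfl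
  have hM : ∀ i (c : κ) (x : P), M i (c ⊗ₜ[A] x) = c * algebraMap A κ (μ i x) := by
    intro i c x
    simp [M]
  have hexp : ∀ ψ : Module.Dual κ (κ ⊗[A] P), ψ = ∑ i, E ψ i • M i := by
    intro ψ
    refine LinearMap.ext fun z => ?_
    induction z using TensorProduct.induction_on with
    | zero => simp
    | add x y hx hy => rw [map_add, map_add, ← hx, ← hy]
    | tmul c x =>
      simp only [LinearMap.sum_apply, LinearMap.smul_apply, hM, hE, smul_eq_mul]
      conv_lhs => rw [← h x, TensorProduct.tmul_sum, map_sum]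
      refine Finset.sum_congr rfl fun i _ => ?_
      have : c ⊗ₜ[A] (μ i x • b i) = (c * algebraMap A κ (μ i x)) • ((1 : κ) ⊗ₜ[A] b i) := by
        rw [← TensorProduct.smul_tmul, TensorProduct.smul_tmul', smul_eq_mul, mul_one,
          Algebra.smul_def, mul_comm]
      rw [this, map_smul, smul_eq_mul, mul_comm]
  have hinj : Function.Injective E := by
    intro ψ ψ' hψ
    rw [hexp ψ, hexp ψ', hψ]
  have htop : Submodule.span κ (Set.range M) = ⊤ := by
    rw [eq_top_iff]
    intro ψ _
    rw [hexp ψ]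
    exact Submodule.sum_mem _ fun i _ => Submodule.smul_mem _ _ (Submodule.subset_span ⟨i, rfl⟩)
  have hEM : (Set.range fun i => fun j => algebraMap A κ (μ i (b j))) = E '' Set.range M := by
    rw [← Set.range_comp]
    congr 1
    funext i j
    simp [hE, hM]
  rw [hEM, ← Submodule.map_span, htop, Submodule.map_top, LinearMap.finrank_range_of_inj hinj,
    Subspace.dual_finrank_eq]

lemma finrank_of_hrank [Module.Finite A P] [Module.Projective A P]
    (r : ℕ) (hrank : ∀ p : PrimeSpectrum A, Module.rankAtStalk P p = r)
    (κ : Type*) [Field κ] [Algebra A κ] : Module.finrank κ (κ ⊗[A] P) = r := by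
  have h1 := Module.rankAtStalk_baseChange (R := A) (M := P) (S := κ) ⟨⊥, Ideal.isPrime_bot⟩
  rw [hrank, Module.rankAtStalk_eq_finrank_of_free] at h1
  simpa using h1

lemma rank_prime {N : ℕ} (b : Fin N → P) (μ : Fin N → P →ₗ[A] A)
    (h : ∀ x, ∑ i, μ i x • b i = x) (κ : Type*) [Field κ] [Algebra A κ]
    (u : A) (hu : algebraMap A κ u ≠ 0) (c : Fin N → A) (l : P →ₗ[A] A) :
    Module.finrank κ (κ ⊗[A] P) ≤ Module.finrank κ (Submodule.span κ (Set.range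
      fun i => fun j => algebraMap A κ ((u • μ i - c i • l) (b j)))) + 1 := by
  rw [rank_dual b μ h κ]
  set V := Submodule.span κ (Set.range
      fun i => fun j => algebraMap A κ ((u • μ i - c i • l) (b j))) with hV
  let L : Fin N → κ := fun j => algebraMap A κ (l (b j))
  have hVf : Module.Finite κ V := Module.Finite.span_of_finite κ (Set.finite_range _)
  have hle : Submodule.span κ (Set.range fun i => fun j => algebraMap A κ (μ i (b j))) ≤
      V ⊔ Submodule.span κ {L} := by
    rw [Submodule.span_le]
    rintro _ ⟨i, rfl⟩
    refine (Submodule.smul_mem_iff _ hu).mp ?_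
    have h1 : (algebraMap A κ u • fun j => algebraMap A κ (μ i (b j))) =
        (fun j => algebraMap A κ ((u • μ i - c i • l) (b j))) + algebraMap A κ (c i) • L := by
      funext j
      simp [L, Algebra.smul_def]
    rw [h1]
    exact Submodule.add_mem_sup (Submodule.subset_span ⟨i, rfl⟩)
      (Submodule.smul_mem _ _ (Submodule.mem_span_singleton_self _))
  refine (Submodule.finrank_mono hle).trans ?_
  refine (Submodule.finrank_add_le_finrank_add_finrank _ _).trans ?_
  have := finrank_span_le_card (R := κ) ({L} : Set (Fin N → κ))
  simp only [Set.toFinset_singleton, Finset.card_singleton] at this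
  omega

/-- Eisenbud–Evans for functionals. -/
lemma ee_fun {B : Type*} [CommRing B] [Algebra A B] [IsNoetherianRing B] {N n : ℕ} (b : Fin N → P)
    (K : Ideal B) (e : B) (d : PrimeSpectrum B → ℕ)
    (hd : ∀ p q : PrimeSpectrum B, K ≤ p.asIdeal → K ≤ q.asIdeal → q < p → d p + 1 ≤ d q)
    (φ : P →ₗ[A] B) (l : Fin n → P →ₗ[A] B)
    (hrk : ∀ p : PrimeSpectrum B, K ≤ p.asIdeal → e ∉ p.asIdeal →
      d p + 1 ≤ rk p (fun i : Fin n => fun j => l i (b j))) :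
    ∃ y ∈ Submodule.span B (Set.range l), ∀ p : PrimeSpectrum B, K ≤ p.asIdeal → e ∉ p.asIdeal →
      ∃ j, (φ + e • y) (b j) ∉ p.asIdeal := by
  let ev : (P →ₗ[A] B) →ₗ[B] (Fin N → B) :=
    { toFun := fun ψ j => ψ (b j)
      map_add' := fun _ _ => rfl
      map_smul' := fun _ _ => rfl }
  obtain ⟨y, hy, hy2⟩ := eisenbud_evans K e d hd n (Fin.cons (ev φ) fun i => ev (l i)) (by
    intro p hK he
    refine (min_le_right _ _).trans ((hrk p hK he).trans ?_)
    have : Module.Finite p.asIdeal.ResidueField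
        (spn p (Fin.cons (ev φ) fun i => ev (l i) : Fin (n+1) → Fin N → B)) :=
      Module.Finite.span_of_finite _ (Set.finite_range _)
    refine Submodule.finrank_mono (Submodule.span_mono ?_)
    rintro _ ⟨i, rfl⟩
    exact ⟨i.succ, rfl⟩)
  simp only [Fin.cons_succ, Fin.cons_zero] at hy hy2
  have hy' : y ∈ Submodule.map ev (Submodule.span B (Set.range l)) := by
    rw [Submodule.map_span, ← Set.range_comp]
    exact hy
  obtain ⟨z, hz, rfl⟩ := hy'
  exact ⟨z, hz, fun p hK he => hy2 p hK he⟩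

end DualBasis
end MRS

namespace MRS

section Core
variable {A : Type*} [CommRing A] {P : Type*} [AddCommGroup P] [Module A P]

lemma span_le_sup_of_sub_mem (v v' : P →ₗ[A] A[X]) (L : Ideal A[X]) (h : ∀ p, v p - v' p ∈ L) :
    Ideal.span (Set.range v) ≤ Ideal.span (Set.range v') ⊔ L := by
  rw [Ideal.span_le]
  rintro _ ⟨p, rfl⟩
  have : v p = v' p + (v p - v' p) := by ring
  rw [SetLike.mem_coe, this]
  exact Submodule.add_mem_sup (Ideal.subset_span ⟨p, rfl⟩) (h p)

/-- Step 1: adjust `δ` so that it lifts `ρ`. -/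
lemma exists_step1 [Module.Projective A P] (I₁ : Ideal A[X]) (𝔟 : Ideal A) (s : A) (hs : s ∈ 𝔟)
    (ρ : P →ₗ[A] A) (hρ : LinearMap.range ρ = (I₁ ⊓ 𝔟.map C).map (evalRingHom (0 : A)))
    (δ : P →ₗ[A] A[X]) (hδ : ∀ p, δ p ∈ I₁)
    (hsurj : I₁ ≤ Ideal.span (Set.range δ) ⊔ I₁ ^ 2)
    (hδ0 : ∀ p, eval 0 (δ p) - ρ p ∈ (I₁.map (evalRingHom (0 : A))) ^ 2) :
    ∃ v : P →ₗ[A] A[X], (∀ p, eval 0 (v p) = ρ p) ∧ (∀ p, v p ∈ I₁) ∧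
      I₁ ≤ Ideal.span (Set.range v) ⊔ I₁ ^ 2 ∧
      ∀ h ∈ I₁, C (s ^ 2) * h ∈ Ideal.span (Set.range v) ⊔ (I₁ ^ 2 ⊓ Ideal.span {X}) := by
  have hevs : Function.Surjective (evalRingHom (0 : A)) := fun a => ⟨C a, by simp⟩
  let M : Submodule A A[X] := (I₁ ^ 2).restrictScalars A
  let Q : Submodule A A := (I₁.map (evalRingHom (0 : A))) ^ 2
  let ev : M →ₗ[A] Q := (leval (0 : A)).restrict (p := M) (q := Q) (by
    intro x hx
    have : evalRingHom (0 : A) x ∈ (I₁ ^ 2).map (evalRingHom (0 : A)) := Ideal.mem_map_of_mem _ hx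
    rw [Ideal.map_pow] at this
    exact this)
  have hev : Function.Surjective ev := by
    rintro ⟨y, hy⟩
    have hy' : y ∈ (I₁ ^ 2).map (evalRingHom (0 : A)) := by
      rw [Ideal.map_pow]
      exact hy
    obtain ⟨x, hx, hxy⟩ := (Ideal.mem_map_iff_of_surjective _ hevs).mp hy'
    exact ⟨⟨x, hx⟩, Subtype.ext hxy⟩
  let D : P →ₗ[A] Q := LinearMap.codRestrict Q (leval (0 : A) ∘ₗ δ - ρ) hδ0
  obtain ⟨k, hk⟩ := Module.projective_lifting_property ev D hev
  let κ : P →ₗ[A] A[X] := M.subtype ∘ₗ k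
  have hκI : ∀ p, κ p ∈ I₁ ^ 2 := fun p => (k p).2
  have hκ0 : ∀ p, eval 0 (κ p) = eval 0 (δ p) - ρ p := by
    intro p
    have := congrArg Subtype.val (LinearMap.congr_fun hk p)
    exact this
  have hI2 : I₁ ^ 2 ≤ I₁ := Ideal.pow_le_self (by norm_num)
  let v := δ - κ
  have hv0 : ∀ p, eval 0 (v p) = ρ p := by
    intro p
    simp [v, hκ0]
  have hvI : ∀ p, v p ∈ I₁ := fun p => I₁.sub_mem (hδ p) (hI2 (hκI p))
  have hvs : I₁ ≤ Ideal.span (Set.range v) ⊔ I₁ ^ 2 := by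
    refine hsurj.trans (sup_le ?_ le_sup_right)
    refine span_le_sup_of_sub_mem δ v _ fun p => ?_
    simp only [v, LinearMap.sub_apply, sub_sub_cancel]
    exact hκI p
  refine ⟨v, hv0, hvI, hvs, ?_⟩
  set V := Ideal.span (Set.range v) with hV
  have claim : ∀ a ∈ I₁, ∃ p x, C s * a = v p + x ∧ x ∈ I₁ ∧ x ∈ Ideal.span {(X : A[X])} := by
    intro a ha
    have h1 : eval 0 (C s * a) ∈ LinearMap.range ρ := by
      rw [hρ]
      exact Ideal.mem_map_of_mem (evalRingHom (0 : A)) (⟨I₁.mul_mem_left _ ha,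
        Ideal.mul_mem_right _ _ (Ideal.mem_map_of_mem _ hs)⟩ : C s * a ∈ I₁ ⊓ 𝔟.map C)
    obtain ⟨p, hp⟩ := h1
    refine ⟨p, C s * a - v p, by ring, I₁.sub_mem (I₁.mul_mem_left _ ha) (hvI p), ?_⟩
    rw [Ideal.mem_span_singleton, X_dvd_iff, coeff_zero_eq_eval_zero, eval_sub, hv0, hp, sub_self]
  intro h hh
  obtain ⟨x, hx, y, hy, rfl⟩ := Submodule.mem_sup.mp (hvs hh)
  rw [mul_add]
  refine Ideal.add_mem _ (Submodule.mem_sup_left (V.mul_mem_left _ hx)) ?_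
  rw [pow_two I₁] at hy
  refine Submodule.mul_induction_on hy ?_ ?_
  · intro a ha b hb
    obtain ⟨p, x, hax, hxI, hxX⟩ := claim a ha
    obtain ⟨q, z, hbz, hzI, hzX⟩ := claim b hb
    have h1 : C (s ^ 2) * (a * b) = (v p * (C s * b) + x * v q) + x * z := by
      have : C (s ^ 2) * (a * b) = (C s * a) * (C s * b) := by rw [C_pow]; ring
      rw [this, hax, hbz]
      ring
    rw [h1]
    refine Submodule.add_mem_sup (V.add_mem (V.mul_mem_right _ (Ideal.subset_span ⟨p, rfl⟩))
      (V.mul_mem_left _ (Ideal.subset_span ⟨q, rfl⟩))) ⟨?_, Ideal.mul_mem_right _ _ hxX⟩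
    rw [pow_two]
    exact Ideal.mul_mem_mul hxI hzI
  · intro a b ha hb
    rw [mul_add]
    exact Ideal.add_mem _ ha hb

theorem core [IsNoetherianRing A] [Module.Finite A P] [Module.Projective A P]
    (r : ℕ) (hrank : ∀ p : PrimeSpectrum A, Module.rankAtStalk P p = r)
    (I₁ : Ideal A[X]) (𝔟 : Ideal A) (hcomax : I₁ ⊔ 𝔟.map C = ⊤)
    (hmonic : ∃ f ∈ I₁, f.Monic)
    (hdim : ringKrullDim (A[X] ⧸ I₁) + 2 ≤ (r : WithBot ℕ∞))
    (ρ : P →ₗ[A] A) (hρ : LinearMap.range ρ = (I₁ ⊓ 𝔟.map C).map (evalRingHom (0 : A)))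
    (δ : P →ₗ[A] A[X]) (hδ : ∀ p, δ p ∈ I₁)
    (hsurj : I₁ ≤ Ideal.span (Set.range δ) ⊔ I₁ ^ 2)
    (hδ0 : ∀ p, eval 0 (δ p) - ρ p ∈ (I₁.map (evalRingHom (0 : A))) ^ 2) :
    ∃ w : P →ₗ[A] A[X], Ideal.span (Set.range w) = I₁ ⊓ 𝔟.map C ∧
      ∀ p, eval 0 (w p) = ρ p := by
  rcases subsingleton_or_nontrivial A with _ | _
  · exact ⟨0, Subsingleton.elim _ _, fun p => Subsingleton.elim _ _⟩
  obtain ⟨f, hfI, hfm⟩ := hmonic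
  set J : Ideal A := I₁.comap C with hJ
  have hJmap : J.map C ≤ I₁ := Ideal.map_comap_le
  -- Step 0
  obtain ⟨s, hsb, hsJ⟩ : ∃ s, s ∈ 𝔟 ∧ s - 1 ∈ J := by
    obtain ⟨s', h1, h2⟩ := exists_C_mem_of_comax I₁ 𝔟 f hfI f.natDegree le_rfl
      (by rw [coeff_natDegree, hfm.leadingCoeff, sub_self]; exact 𝔟.zero_mem) hcomax
    refine ⟨1 - s', ?_, ?_⟩
    · rw [← neg_sub]; exact 𝔟.neg_mem h1
    · rw [sub_sub_cancel_left]; exact J.neg_mem h2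
  -- Step 1
  obtain ⟨v₀, hv₀0, hv₀I, hv₀s, hv₀L⟩ := exists_step1 I₁ 𝔟 s hsb ρ hρ δ hδ hsurj hδ0
  set L : Ideal A[X] := I₁ ^ 2 ⊓ Ideal.span {X} with hL
  have hI2 : I₁ ^ 2 ≤ I₁ := Ideal.pow_le_self (by norm_num)
  have hLI2 : L ≤ I₁ ^ 2 := inf_le_left
  have hLI : L ≤ I₁ := hLI2.trans hI2
  have hL0 : ∀ x ∈ L, eval 0 x = 0 := by
    intro x hx
    rw [← coeff_zero_eq_eval_zero, ← X_dvd_iff]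
    exact Ideal.mem_span_singleton.mp hx.2
  -- dual basis and dimension function
  obtain ⟨N, b, μ, hμ⟩ := exists_dual_basis (A := A) (P := P)
  let dA : PrimeSpectrum A → ℕ := fun p => (Order.coheight p).toNat
  have hcoe : ∀ p : PrimeSpectrum A, J ≤ p.asIdeal → (dA p : ℕ∞) = Order.coheight p := by
    intro p hp
    have h1 := coheight_bound I₁ f hfI hfm r hdim p hp
    refine ENat.natCast_toNat fun h => ?_
    rw [h, top_add, top_le_iff] at h1
    exact ENat.natCast_ne_top r h1
  have hdA2 : ∀ p : PrimeSpectrum A, J ≤ p.asIdeal → dA p + 2 ≤ r := by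
    intro p hp
    have h1 := coheight_bound I₁ f hfI hfm r hdim p hp
    rw [← hcoe p hp] at h1
    exact_mod_cast h1
  have hdA : ∀ p q : PrimeSpectrum A, J ≤ p.asIdeal → J ≤ q.asIdeal → q < p →
      dA p + 1 ≤ dA q := by
    intro p q hp hq hqp
    have h1 := Order.coheight_add_one_le hqp
    rw [← hcoe p hp, ← hcoe q hq] at h1
    exact_mod_cast h1
  -- Step 2
  obtain ⟨l, p₁, hu⟩ : ∃ (l : P →ₗ[A] A) (p₁ : P), l p₁ - 1 ∈ J := by
    obtain ⟨l, -, hl⟩ := ee_fun b J (1 : A) dA hdA (0 : P →ₗ[A] A) μ (by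
      intro p hp _
      have h1 := rank_dual b μ hμ p.asIdeal.ResidueField
      rw [finrank_of_hrank r hrank] at h1
      have h2 : rk p (fun i => fun j => μ i (b j)) = r := h1.symm
      have := hdA2 p hp
      omega)
    have htop : LinearMap.range l ⊔ J = ⊤ := by
      by_contra hne
      obtain ⟨𝔪, h𝔪, hle⟩ := Ideal.exists_le_maximal _ hne
      obtain ⟨j, hj⟩ := hl ⟨𝔪, h𝔪.isPrime⟩ (le_sup_right.trans hle)
        (fun h => h𝔪.ne_top ((Ideal.eq_top_iff_one _).mpr h))
      refine hj (hle (Submodule.mem_sup_left ⟨b j, ?_⟩))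
      simp
    have h1 : (1 : A) ∈ LinearMap.range l ⊔ J := by rw [htop]; trivial
    obtain ⟨_, ⟨p₁, rfl⟩, y, hy, hxy⟩ := Submodule.mem_sup.mp h1
    refine ⟨l, p₁, ?_⟩
    rw [← hxy, sub_add_cancel_left]
    exact J.neg_mem hy
  set u := l p₁ with hudef
  -- Step 3
  let ι : A →ₗ[A] A[X] := Algebra.linearMap A A[X]
  let g : A[X] := f ^ 2 * X ^ ((v₀ p₁).natDegree + 1)
  let n := g.natDegree
  have hgm : g.Monic := (hfm.pow 2).mul (monic_X_pow _)
  have hgL : g ∈ L := ⟨Ideal.mul_mem_right _ _ (Ideal.pow_mem_pow hfI 2),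
    Ideal.mul_mem_left _ _ (Ideal.mem_span_singleton.mpr (dvd_pow_self _ (by omega)))⟩
  let v₁ : P →ₗ[A] A[X] := v₀ + g • (ι ∘ₗ l)
  have hv₁ : ∀ p, v₁ p = v₀ p + g * C (l p) := fun p => rfl
  have hv₁0 : ∀ p, eval 0 (v₁ p) = ρ p := by
    intro p
    rw [hv₁, eval_add, hv₀0, eval_mul, hL0 g hgL, zero_mul, add_zero]
  have hv₁I : ∀ p, v₁ p ∈ I₁ := fun p => I₁.add_mem (hv₀I p) (I₁.mul_mem_right _ (hLI hgL))
  set V₁ := Ideal.span (Set.range v₁) with hV₁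
  have hV₀₁ : Ideal.span (Set.range v₀) ≤ V₁ ⊔ L := by
    refine span_le_sup_of_sub_mem v₀ v₁ L fun p => ?_
    rw [hv₁, sub_add_cancel_left]
    exact L.neg_mem (L.mul_mem_right _ hgL)
  have hv₁s : I₁ ≤ V₁ ⊔ I₁ ^ 2 :=
    hv₀s.trans (sup_le (hV₀₁.trans (sup_le_sup_left hLI2 _)) le_sup_right)
  have hv₁L : ∀ h ∈ I₁, C (s ^ 2) * h ∈ V₁ ⊔ L := fun h hh =>
    (sup_le hV₀₁ le_sup_right) (hv₀L h hh)
  have hV₁I : V₁ ≤ I₁ := by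
    rw [hV₁, Ideal.span_le]
    rintro _ ⟨p, rfl⟩
    exact hv₁I p
  set f₁ := v₁ p₁ with hf₁
  have hdegv : (v₀ p₁).natDegree < n := by
    have : n = (f ^ 2).natDegree + ((v₀ p₁).natDegree + 1) := by
      simp only [n, g]
      rw [Monic.natDegree_mul (hfm.pow 2) (monic_X_pow _), natDegree_X_pow]
    omega
  have hf₁deg : f₁.natDegree ≤ n := by
    rw [hf₁, hv₁]
    refine natDegree_add_le_of_degree_le hdegv.le ?_
    exact natDegree_mul_C_le _ _
  have hf₁c : f₁.coeff n = u := by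
    rw [hf₁, hv₁, coeff_add, coeff_eq_zero_of_natDegree_lt hdegv, zero_add, coeff_mul_C]
    have : g.coeff n = 1 := hgm.coeff_natDegree
    rw [this, one_mul]
  -- Step 4
  obtain ⟨e, heL, heV⟩ : ∃ e ∈ L, ∀ h ∈ I₁, (C (s ^ 2) - e) * h ∈ V₁ := by
    obtain ⟨x, hx1, hx2⟩ := Submodule.exists_sub_one_mem_and_smul_le_of_fg_of_le_sup
      (I := I₁) (N := V₁) (N' := I₁) (P := I₁) (IsNoetherian.noetherian _) le_rfl (by
        rw [smul_eq_mul, ← pow_two]; exact hv₁s)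
    have hx3 : 1 - x ∈ I₁ := by rw [← neg_sub]; exact I₁.neg_mem hx1
    obtain ⟨y, hy, e, he, hye⟩ := Submodule.mem_sup.mp (hv₁L _ hx3)
    refine ⟨e, he, fun h hh => ?_⟩
    have h1 : (C (s ^ 2) - e) * h = y * h + C (s ^ 2) * (x * h) := by
      have : e = C (s ^ 2) * (1 - x) - y := by rw [← hye]; ring
      rw [this]; ring
    rw [h1]
    refine V₁.add_mem (V₁.mul_mem_right _ hy) (V₁.mul_mem_left _ (hx2 ?_))
    exact Submodule.smul_mem_pointwise_smul _ _ _ hh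
  -- Step 5
  let K : Ideal A[X] := J.map C ⊔ Ideal.span {f₁}
  have hKJ : ∀ 𝔓 : PrimeSpectrum A[X], K ≤ 𝔓.asIdeal →
      J ≤ (PrimeSpectrum.comap C 𝔓).asIdeal := by
    intro 𝔓 h
    exact Ideal.map_le_iff_le_comap.mp (le_sup_left.trans h)
  have hKm : ∃ m ∈ K, m.Monic := by
    refine ⟨f₁ - C (u - 1) * X ^ n, K.sub_mem (Submodule.mem_sup_right
      (Ideal.mem_span_singleton_self _)) (Submodule.mem_sup_left
      (Ideal.mul_mem_right _ _ (Ideal.mem_map_of_mem _ hu))), ?_⟩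
    refine monic_of_natDegree_le_of_coeff_eq_one n ?_ ?_
    · exact (natDegree_sub_le _ _).trans (max_le hf₁deg (natDegree_C_mul_X_pow_le _ _))
    · rw [coeff_sub, hf₁c, coeff_C_mul_X_pow, if_pos rfl, sub_sub_cancel]
  obtain ⟨m, hmK, hmm⟩ := hKm
  let l' : Fin N → P →ₗ[A] A[X] := fun i => ι ∘ₗ (u • μ i - (μ i p₁) • l)
  obtain ⟨y, hy, hyK⟩ := ee_fun b K e (fun 𝔓 => dA (PrimeSpectrum.comap C 𝔓)) (by
      intro p q hp hq hqp
      exact hdA _ _ (hKJ p hp) (hKJ q hq) (comap_C_lt q p m (hq hmK) hmm hqp)) v₁ l' (by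
      intro 𝔓 h𝔓 _
      have hu' : algebraMap A 𝔓.asIdeal.ResidueField u ≠ 0 := by
        rw [IsScalarTower.algebraMap_apply A A[X] 𝔓.asIdeal.ResidueField, ne_eq,
          Ideal.algebraMap_residueField_eq_zero]
        intro h
        have h1 : C (u - 1) ∈ 𝔓.asIdeal := hKJ 𝔓 h𝔓 hu
        rw [C_sub, C_1] at h1
        have h2 := 𝔓.asIdeal.sub_mem h h1
        rw [algebraMap_eq, sub_sub_cancel] at h2
        exact 𝔓.isPrime.ne_top ((Ideal.eq_top_iff_one _).mpr h2)
      have h1 := rank_prime b μ hμ 𝔓.asIdeal.ResidueField u hu' (fun i => μ i p₁) l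
      rw [finrank_of_hrank r hrank] at h1
      have h2 : rk 𝔓 (fun i => fun j => l' i (b j)) =
          Module.finrank 𝔓.asIdeal.ResidueField (Submodule.span 𝔓.asIdeal.ResidueField (Set.range
      fun i => fun j => algebraMap A 𝔓.asIdeal.ResidueField ((u • μ i - μ i p₁ • l) (b j)))) := by
        have h3 : (fun i => red 𝔓 (fun j => l' i (b j))) = fun i => fun j =>
            algebraMap A 𝔓.asIdeal.ResidueField ((u • μ i - μ i p₁ • l) (b j)) := by
          funext i j
          rw [IsScalarTower.algebraMap_apply A A[X] 𝔓.asIdeal.ResidueField]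
          rfl
        rw [rk, spn, h3]
      have := hdA2 _ (hKJ 𝔓 h𝔓)
      omega)
  have hyp₁ : y p₁ = 0 := by
    refine Submodule.span_induction (p := fun y _ => y p₁ = 0) ?_ ?_ ?_ ?_ hy
    · rintro _ ⟨i, rfl⟩
      simp only [l', LinearMap.comp_apply, LinearMap.sub_apply, LinearMap.smul_apply, smul_eq_mul,
        ← hudef]
      rw [mul_comm, sub_self, map_zero]
    · rfl
    · intro x y _ _ hx hy
      rw [LinearMap.add_apply, hx, hy, add_zero]
    · intro a x _ hx
      rw [LinearMap.smul_apply, hx, smul_zero]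
  let φ : P →ₗ[A] A[X] := v₁ + e • y
  have hφ : ∀ p, φ p = v₁ p + e * y p := fun p => rfl
  have hφp₁ : φ p₁ = f₁ := by rw [hφ, hyp₁, mul_zero, add_zero]
  have hφI : ∀ p, φ p ∈ I₁ := fun p => I₁.add_mem (hv₁I p) (I₁.mul_mem_right _ (hLI heL))
  have hφ0 : ∀ p, eval 0 (φ p) = ρ p := by
    intro p
    rw [hφ, eval_add, hv₁0, eval_mul, hL0 e heL, zero_mul, add_zero]
  set N' := Ideal.span (Set.range φ) with hN'
  have hf₁N : f₁ ∈ N' := Ideal.subset_span ⟨p₁, hφp₁⟩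
  have hV₁N : V₁ ≤ N' ⊔ Ideal.span {e} := by
    refine span_le_sup_of_sub_mem v₁ φ _ fun p => ?_
    rw [hφ, sub_add_cancel_left]
    exact neg_mem (Ideal.mul_mem_right _ _ (Ideal.mem_span_singleton_self _))
  have hIN : I₁ ≤ N' ⊔ I₁ ^ 2 := by
    refine hv₁s.trans (sup_le (hV₁N.trans (sup_le_sup_left ?_ _)) le_sup_right)
    rw [Ideal.span_singleton_le_iff_mem]
    exact hLI2 heL
  -- Step 6
  let c : Ideal A[X] := N'.colon I₁
  have hc : ∀ x, x ∈ c ↔ ∀ h ∈ I₁, x * h ∈ N' := by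
    intro x
    exact Submodule.mem_colon
  have hNc : N' ≤ c := fun x hx => (hc x).mpr fun h _ => N'.mul_mem_right _ hx
  have hctop : c ⊔ J.map C = ⊤ := by
    by_contra hne
    obtain ⟨𝔮, h𝔮, hle⟩ := Ideal.exists_le_maximal _ hne
    have hc𝔮 : c ≤ 𝔮 := le_sup_left.trans hle
    have hJ𝔮 : J.map C ≤ 𝔮 := le_sup_right.trans hle
    have hone : (1 : A[X]) ∉ 𝔮 := fun h => h𝔮.ne_top ((Ideal.eq_top_iff_one _).mpr h)
    have hK𝔮 : K ≤ 𝔮 := sup_le hJ𝔮 (by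
      rw [Ideal.span_singleton_le_iff_mem]
      exact hc𝔮 (hNc hf₁N))
    have hI𝔮 : ¬ I₁ ≤ 𝔮 := by
      intro hI
      obtain ⟨x, hx1, hx2⟩ := Submodule.exists_sub_one_mem_and_smul_le_of_fg_of_le_sup
        (I := I₁) (N := N') (N' := I₁) (P := I₁) (IsNoetherian.noetherian _) le_rfl (by
          rw [smul_eq_mul, ← pow_two]; exact hIN)
      have hxc : x ∈ c := (hc x).mpr fun h hh => hx2 (Submodule.smul_mem_pointwise_smul _ _ _ hh)
      have h2 := 𝔮.sub_mem (hc𝔮 hxc) (hI hx1)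
      rw [sub_sub_cancel] at h2
      exact hone h2
    by_cases he : e ∈ 𝔮
    · refine hI𝔮 fun h hh => ?_
      have h1 : (C (s ^ 2) - e) * h ∈ 𝔮 := by
        refine (sup_le (hNc.trans hc𝔮) ?_) (hV₁N (heV h hh))
        rwa [Ideal.span_singleton_le_iff_mem]
      refine (h𝔮.isPrime.mem_or_mem h1).resolve_left fun h2 => ?_
      have h3 : C (s ^ 2) ∈ 𝔮 := by
        have := 𝔮.add_mem h2 he
        rwa [sub_add_cancel] at this
      rw [C_pow] at h3
      have h4 : C s ∈ 𝔮 := h𝔮.isPrime.mem_of_pow_mem 2 h3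
      have h5 : C (s - 1) ∈ 𝔮 := hJ𝔮 (Ideal.mem_map_of_mem _ hsJ)
      have h6 := 𝔮.sub_mem h4 h5
      rw [C_sub, C_1, sub_sub_cancel] at h6
      exact hone h6
    · obtain ⟨j, hj⟩ := hyK ⟨𝔮, h𝔮.isPrime⟩ hK𝔮 he
      exact hj (hc𝔮 (hNc (Ideal.subset_span ⟨b j, rfl⟩)))
  obtain ⟨s', hs'J, hs'c⟩ := exists_C_mem_of_comax c J f₁ (hNc hf₁N) n hf₁deg
    (by rw [hf₁c]; exact hu) hctop
  -- Step 7
  refine exists_final I₁ 𝔟 ρ φ (s * s') ?_ (𝔟.mul_mem_right _ hsb) hφ0 hρ hφI ?_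
  · have h1 : s * s' - 1 = s * (s' - 1) + (s - 1) := by ring
    rw [h1]
    exact J.add_mem (J.mul_mem_left _ hs'J) hsJ
  · intro h hh
    rw [C_mul, mul_assoc]
    exact N'.mul_mem_left _ ((hc _).mp hs'c h hh)

end Core
end MRS

/-- **Mandal–Raja Sridharan theorem.**  Let `A` be Noetherian, `R = A[T]`, and `I₁, I₂`
comaximal ideals of `R` with `I₁` containing a monic polynomial and `I₂` extended from
`A` (i.e. `I₂ = I₂(0)R`).  Let `P` be a finitely generated projective `A`-module of
constant rank `r ≥ dim (R/I₁) + 2` and `I = I₁ ∩ I₂`.  Given `ρ : P ↠ I(0)` and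
`δ : P[T] ↠ I₁/I₁²` with `δ(0) ≡ ρ mod I₁(0)²`, there is `η : P[T] ↠ I` with
`η(0) = ρ`. -/
theorem mandal_raja_sridharan {A : Type*} [CommRing A] [IsNoetherianRing A]
    {P : Type*} [AddCommGroup P] [Module A P] [Module.Finite A P] [Module.Projective A P]
    (r : ℕ) (hrank : ∀ p : PrimeSpectrum A, Module.rankAtStalk P p = r)
    (I₁ I₂ : Ideal A[X]) (hcomax : I₁ ⊔ I₂ = ⊤)
    (hmonic : ∃ f ∈ I₁, f.Monic)
    (hext : I₂ = Ideal.map (Polynomial.C : A →+* A[X]) (I₂.map (evalRingHom (0 : A))))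
    (hdim : ringKrullDim (A[X] ⧸ I₁) + 2 ≤ (r : WithBot ℕ∞))
    (ρ : P →ₗ[A] A)
    (hρ : LinearMap.range ρ = (I₁ ⊓ I₂).map (evalRingHom (0 : A)))
    (δ : TensorProduct A A[X] P →ₗ[A[X]] A[X])
    (hδ : LinearMap.range δ ≤ I₁)
    (hδsurj : LinearMap.range δ ⊔ I₁ ^ 2 = I₁)
    (hδ0 : ∀ p : P, eval 0 (δ ((1 : A[X]) ⊗ₜ[A] p)) - ρ p
      ∈ (I₁.map (evalRingHom (0 : A))) ^ 2) :
    ∃ η : TensorProduct A A[X] P →ₗ[A[X]] A[X],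
      LinearMap.range η = I₁ ⊓ I₂ ∧
      ∀ p : P, eval 0 (η ((1 : A[X]) ⊗ₜ[A] p)) = ρ p := by
  have hrange : ∀ η : TensorProduct A A[X] P →ₗ[A[X]] A[X],
      LinearMap.range η = Ideal.span (Set.range fun p : P => η ((1 : A[X]) ⊗ₜ[A] p)) := by
    intro η
    refine le_antisymm ?_ ?_
    · rintro _ ⟨z, rfl⟩
      induction z using TensorProduct.induction_on with
      | zero => rw [map_zero]; exact Submodule.zero_mem _
      | add x y hx hy => rw [map_add]; exact Submodule.add_mem _ hx hy
      | tmul a x =>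
        have : a ⊗ₜ[A] x = a • ((1 : A[X]) ⊗ₜ[A] x) := by
          rw [TensorProduct.smul_tmul', smul_eq_mul, mul_one]
        rw [this, map_smul]
        exact Submodule.smul_mem _ _ (Submodule.subset_span ⟨x, rfl⟩)
    · refine Submodule.span_le.mpr ?_
      rintro _ ⟨p, rfl⟩
      exact ⟨_, rfl⟩
  let δ' : P →ₗ[A] A[X] := (δ.restrictScalars A) ∘ₗ (TensorProduct.mk A A[X] P 1)
  have hδ' : Ideal.span (Set.range δ') = LinearMap.range δ := (hrange δ).symm
  obtain ⟨w, hw, hw0⟩ := MRS.core r hrank I₁ (I₂.map (evalRingHom (0 : A)))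
    (by rw [← hext]; exact hcomax) hmonic hdim ρ (by rw [← hext]; exact hρ) δ'
    (fun p => hδ ⟨_, rfl⟩) (by rw [hδ']; exact hδsurj.ge) hδ0
  refine ⟨w.liftBaseChange A[X], ?_, fun p => ?_⟩
  · rw [hrange]
    simp only [LinearMap.liftBaseChange_tmul, one_smul]
    rw [← hext] at hw
    exact hw
  · simp only [LinearMap.liftBaseChange_tmul, one_smul]
    exact hw0 p
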